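/- arXiv:1606.06903 — 2 statements merged into one kernel-verified Lean document; each statement's English description precedes it below -/
import Mathlib

section
/- Let 𝐗, 𝐘, Z be pairwise disjoint node sets in a DAG D with 𝐗 and 𝐘 nonempty. If Z blocks every proper non-causal path from 𝐗 to 𝐘 in D, then for every X ∈ 𝐗 and every Y ∈ 𝐘, the set (Z ∪ 𝐗) \ {X} blocks every back-door path from X to Y in D. -/
attribute [local instance] Classical.propDecidable

/-- A finite directed acyclic graph on vertex type `V`. -/
structure DAG (V : Type) [Fintype V] [DecidableEq V] where
  /-- the edge relation: `Edge a b` means there is a directed edge `a → b` -/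
  Edge : V → V → Prop
  /-- there are no directed cycles -/
  acyclic : ∀ v, ¬ Relation.TransGen Edge v v

namespace DAG

variable {V : Type} [Fintype V] [DecidableEq V]

/-- two nodes are adjacent if they are joined by an edge in either direction -/
def Adj (D : DAG V) (a b : V) : Prop := D.Edge a b ∨ D.Edge b a

/-- `p` is a path from `x` to `y`: a list of distinct nodes, consecutive ones adjacent,
starting at `x` and ending at `y`. -/
def IsPathFrom (D : DAG V) (p : List V) (x y : V) : Prop :=
  p.Nodup ∧ p.Chain' D.Adj ∧ p.head? = some x ∧ p.getLast? = some y

/-- a causal (directed) path: all edges point forward -/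
def IsCausal (D : DAG V) (p : List V) : Prop := p.Chain' D.Edge

/-- descendants of a set of nodes (every node is its own descendant) -/
def Desc (D : DAG V) (S : Set V) : Set V :=
  {v | ∃ w ∈ S, Relation.ReflTransGen D.Edge w v}

/-- ancestors of a set of nodes (every node is its own ancestor) -/
def Anc (D : DAG V) (S : Set V) : Set V :=
  {v | ∃ w ∈ S, Relation.ReflTransGen D.Edge v w}

/-- `w` is a collider on the path `p`: both edges of `p` at `w` point into `w` -/
def IsColliderOn (D : DAG V) (p : List V) (w : V) : Prop :=
  ∃ a b, [a, w, b] <:+: p ∧ D.Edge a w ∧ D.Edge b w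

/-- `w` is a non-collider on `p`: a non-endpoint node of `p` that is not a collider on `p` -/
def IsNonColliderOn (D : DAG V) (p : List V) (w : V) : Prop :=
  (∃ a b, [a, w, b] <:+: p) ∧ ¬ D.IsColliderOn p w

/-- `Z` blocks the path `p`: some non-collider on `p` is in `Z`, or some collider on `p`
has no descendant in `Z`.  Otherwise `p` is d-connecting given `Z`. -/
def Blocks (D : DAG V) (Z : Set V) (p : List V) : Prop :=
  (∃ w, D.IsNonColliderOn p w ∧ w ∈ Z) ∨
  (∃ w, D.IsColliderOn p w ∧ D.Desc {w} ∩ Z = ∅)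

/-- `p` is a proper causal path from `X` to `Y` -/
def ProperCausalPath (D : DAG V) (X Y : Set V) (p : List V) : Prop :=
  (∃ x ∈ X, ∃ y ∈ Y, D.IsPathFrom p x y) ∧ (∀ v ∈ p.tail, v ∉ X) ∧ D.IsCausal p

/-- `p` is a proper non-causal path from `X` to `Y` -/
def ProperNonCausalPath (D : DAG V) (X Y : Set V) (p : List V) : Prop :=
  (∃ x ∈ X, ∃ y ∈ Y, D.IsPathFrom p x y) ∧ (∀ v ∈ p.tail, v ∉ X) ∧ ¬ D.IsCausal p

/-- the forbidden set: all descendants of nodes `W ∉ X` lying on a proper causal path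
from `X` to `Y` -/
def Forb (D : DAG V) (X Y : Set V) : Set V :=
  {v | ∃ p w, D.ProperCausalPath X Y p ∧ w ∈ p ∧ w ∉ X ∧
    Relation.ReflTransGen D.Edge w v}

/-- the adjustment criterion of Shpitser et al. / van der Zander et al. -/
def SatisfiesAC (D : DAG V) (X Y Z : Set V) : Prop :=
  Z ∩ D.Forb X Y = ∅ ∧ ∀ p, D.ProperNonCausalPath X Y p → D.Blocks Z p

/-- the constructive set `Adjust(X,Y,D)` -/
def AdjustSet (D : DAG V) (X Y : Set V) : Set V :=
  D.Anc (X ∪ Y) \ (X ∪ Y ∪ D.Forb X Y)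

/-- `Z` d-separates `X` and `Y` in `D`: `Z` blocks every path from `X` to `Y` -/
def DSep (D : DAG V) (X Y Z : Set V) : Prop :=
  ∀ x ∈ X, ∀ y ∈ Y, ∀ p, D.IsPathFrom p x y → D.Blocks Z p

/-- `p` is a back-door path from `x`: its first edge points into `x` -/
def IsBackdoorFrom (D : DAG V) (p : List V) (x : V) : Prop :=
  ∃ b rest, p = x :: b :: rest ∧ D.Edge b x

/-- Pearl's back-door criterion -/
def BackdoorCriterion (D : DAG V) (X Y Z : Set V) : Prop :=
  Z ∩ D.Desc X = ∅ ∧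
  ∀ x ∈ X, ∀ y ∈ Y, ∀ p, D.IsPathFrom p x y → D.IsBackdoorFrom p x → D.Blocks Z p

/-- the generalized back-door criterion of Maathuis and Colombo -/
def GenBackdoorCriterion (D : DAG V) (X Y Z : Set V) : Prop :=
  Z ∩ D.Desc X = ∅ ∧
  ∀ x ∈ X, ∀ y ∈ Y, ∀ p, D.IsPathFrom p x y → D.IsBackdoorFrom p x →
    D.Blocks ((Z ∪ X) \ {x}) p

end DAG


namespace DAG

variable {V : Type} [Fintype V] [DecidableEq V]

/-- Every consecutive triple of `p` is active given `Z`. -/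
def TriplesActive (D : DAG V) (Z : Set V) (p : List V) : Prop :=
  ∀ a w b, [a, w, b] <:+: p →
    (D.Edge a w ∧ D.Edge b w → ∃ z ∈ Z, Relation.ReflTransGen D.Edge w z) ∧
    (¬ (D.Edge a w ∧ D.Edge b w) → w ∉ Z)

lemma not_edge_symm (D : DAG V) {a b : V} (h : D.Edge a b) : ¬ D.Edge b a := fun h' =>
  D.acyclic a (.tail (.single h) h')

lemma eq_of_append_cons_eq_of_nodup {α : Type*} {w : α} {l₁ l₂ m₁ m₂ : List α}
    (hn : (l₁ ++ w :: l₂).Nodup) (h : l₁ ++ w :: l₂ = m₁ ++ w :: m₂) :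
    l₁ = m₁ ∧ l₂ = m₂ := by
  induction l₁ generalizing m₁ with
  | nil => cases m₁ <;> simp_all
  | cons a l₁ ih => cases m₁ <;> grind

lemma triple_unique_of_nodup {α : Type*} {a a' w b b' : α} {p : List α} (hn : p.Nodup)
    (h : [a, w, b] <:+: p) (h' : [a', w, b'] <:+: p) : a = a' ∧ b = b' := by
  obtain ⟨s, t, rfl⟩ := h
  obtain ⟨s', t', h'⟩ := h'
  have h₁ : s ++ [a, w, b] ++ t = (s ++ [a]) ++ w :: (b :: t) := by simp
  have h₂ : s' ++ [a', w, b'] ++ t' = (s' ++ [a']) ++ w :: (b' :: t') := by simp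
  rw [h₁] at hn h'
  rw [h₂] at h'
  have := eq_of_append_cons_eq_of_nodup hn h'.symm
  simp_all

lemma TriplesActive.not_blocks {D : DAG V} {Z : Set V} {p : List V}
    (h : D.TriplesActive Z p) : ¬ D.Blocks Z p := by
  rintro (⟨w, ⟨⟨a, b, hab⟩, hnc⟩, hw⟩ | ⟨w, ⟨a, b, hab, he⟩, hd⟩)
  · exact (h a w b hab).2 (fun he => hnc ⟨a, b, hab, he⟩) hw
  · obtain ⟨z, hz, hwz⟩ := (h a w b hab).1 he
    exact (hd.subset ⟨⟨w, rfl, hwz⟩, hz⟩ : z ∈ (∅ : Set V))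

lemma triplesActive_of_not_blocks {D : DAG V} {Z : Set V} {p : List V} (hn : p.Nodup)
    (h : ¬ D.Blocks Z p) : D.TriplesActive Z p := by
  intro a w b hab
  refine ⟨fun he => ?_, fun he hw => h (.inl ⟨w, ⟨⟨a, b, hab⟩, ?_⟩, hw⟩)⟩
  · by_contra! hd
    refine h (.inr ⟨w, ⟨a, b, hab, he⟩, Set.eq_empty_of_forall_notMem ?_⟩)
    rintro z ⟨⟨_, rfl, hwz⟩, hz⟩
    exact hd z hz hwz
  · rintro ⟨a', b', hab', he'⟩
    obtain ⟨rfl, rfl⟩ := triple_unique_of_nodup hn hab hab'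
    exact he he'

lemma TriplesActive.of_infix {D : DAG V} {Z : Set V} {p q : List V}
    (h : D.TriplesActive Z p) (hq : q <:+: p) : D.TriplesActive Z q :=
  fun a w b hab => h a w b (hab.trans hq)

lemma TriplesActive.cons {D : DAG V} {Z : Set V} {v w : V} {s : List V}
    (h : D.TriplesActive Z (w :: s)) (hw : w ∉ Z) (hwv : D.Edge w v) :
    D.TriplesActive Z (v :: w :: s) := by
  intro a u b hab
  rcases List.infix_cons_iff.1 hab with hp | hi
  · simp only [List.cons_prefix_cons] at hp
    obtain ⟨rfl, rfl, -⟩ := hp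
    exact ⟨fun he => (D.not_edge_symm hwv he.1).elim, fun _ => hw⟩
  · exact h a u b hi

/-- A path to `y` avoiding `X`, all of whose consecutive triples are active given `Z`. -/
structure IsActiveTail (D : DAG V) (X Z : Set V) (y : V) (p : List V) : Prop where
  nodup : p.Nodup
  chain : p.IsChain D.Adj
  last : p.getLast? = some y
  avoids : ∀ v ∈ p, v ∉ X
  active : D.TriplesActive Z p

lemma IsActiveTail.of_suffix {D : DAG V} {X Z : Set V} {y w : V} {p s : List V}
    (h : D.IsActiveTail X Z y p) (hs : w :: s <:+ p) : D.IsActiveTail X Z y (w :: s) where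
  nodup := h.nodup.sublist hs.sublist
  chain := h.chain.suffix hs
  last := by
    obtain ⟨l, rfl⟩ := hs
    simpa using h.last
  avoids v hv := h.avoids v (hs.mem hv)
  active := h.active.of_infix hs.isInfix

/-- Prepending to an active path avoiding `X` an edge out of its first node that ends in `X`
gives an unblocked proper non-causal path. -/
lemma IsActiveTail.exists_unblocked {D : DAG V} {X Y Z : Set V} {x y w : V} {s : List V}
    (h : D.IsActiveTail X Z y (w :: s)) (hx : x ∈ X) (hy : y ∈ Y) (hwx : D.Edge w x)
    (hact : D.TriplesActive Z (x :: w :: s)) :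
    ∃ p, D.ProperNonCausalPath X Y p ∧ ¬ D.Blocks Z p := by
  refine ⟨x :: w :: s, ⟨⟨x, hx, y, hy, ?_, ?_, rfl, ?_⟩, h.avoids, ?_⟩, hact.not_blocks⟩
  · exact List.nodup_cons.2 ⟨fun hm => h.avoids x hm hx, h.nodup⟩
  · exact List.isChain_cons_cons.2 ⟨.inr hwx, h.chain⟩
  · simpa using h.last
  · exact fun hc => D.not_edge_symm hwx (List.isChain_cons_cons.1 hc).1

/-- Following a directed walk out of the first node of an active path avoiding `X`, and
shortcutting whenever the walk meets the path. -/
lemma IsActiveTail.exists_of_reachable {D : DAG V} {X Y Z : Set V} {y c v : V} {t : List V}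
    (h : D.IsActiveTail X Z y (c :: t)) (hy : y ∈ Y)
    (hc : ∀ z ∈ Z, ¬ Relation.ReflTransGen D.Edge c z)
    (hcv : Relation.ReflTransGen D.Edge c v) :
    (∃ p, D.ProperNonCausalPath X Y p ∧ ¬ D.Blocks Z p) ∨
      ∃ s, D.IsActiveTail X Z y (v :: s) := by
  induction hcv with
  | refl => exact .inr ⟨t, h⟩
  | @tail w v hcw hwv ih =>
    rcases ih with ih | ⟨s, hs⟩
    · exact .inl ih
    have hact := hs.active.cons (fun hw => hc w hw hcw) hwv
    by_cases hv : v ∈ X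
    · exact .inl (hs.exists_unblocked hv hy hwv hact)
    by_cases hvs : v ∈ w :: s
    · obtain ⟨s₁, s₂, he⟩ := List.append_of_mem hvs
      exact .inr ⟨s₂, hs.of_suffix ⟨s₁, he.symm⟩⟩
    · refine .inr ⟨w :: s, List.nodup_cons.2 ⟨hvs, hs.nodup⟩,
        List.isChain_cons_cons.2 ⟨.inr hwv, hs.chain⟩, by simpa using hs.last, ?_, hact⟩
      rintro u (_ | ⟨_, hu⟩)
      · exact hv
      · exact hs.avoids u hu

lemma exists_last_of_mem {α : Type*} {P : α → Prop} {p : List α} (h : ∃ v ∈ p, P v) :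
    ∃ l c t, p = l ++ c :: t ∧ P c ∧ ∀ v ∈ t, ¬ P v := by
  induction p with
  | nil => simp at h
  | cons a p ih =>
    by_cases hp : ∃ v ∈ p, P v
    · obtain ⟨l, c, t, rfl, hc, ht⟩ := ih hp
      exact ⟨a :: l, c, t, rfl, hc, ht⟩
    · push Not at hp
      exact ⟨[], a, p, rfl, by grind, hp⟩

lemma mem_of_triple_infix_cons {α : Type*} {a w b c : α} {t : List α}
    (h : [a, w, b] <:+: c :: t) : w ∈ t := by
  rcases List.infix_cons_iff.1 h with hp | hi
  · exact (List.cons_prefix_cons.1 hp).2.mem (by simp)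
  · exact hi.mem (by simp)

/-- If `Z` blocks every proper non-causal path from `X` to `Y` in `D`,
then for every `x ∈ X` and `y ∈ Y` the set `(Z ∪ X) \ {x}` blocks every back-door path
from `x` to `y` in `D`. -/
theorem blocking_implies_gbc_condition
    (D : DAG V) (X Y Z : Set V)
    (hXY : Disjoint X Y) (hXZ : Disjoint X Z) (hYZ : Disjoint Y Z)
    (hX : X.Nonempty) (hY : Y.Nonempty)
    (hblock : ∀ p, D.ProperNonCausalPath X Y p → D.Blocks Z p) :
    ∀ x ∈ X, ∀ y ∈ Y, ∀ p, D.IsPathFrom p x y → D.IsBackdoorFrom p x →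
      D.Blocks ((Z ∪ X) \ {x}) p := by
  intro x hx y hy p ⟨hn, hch, hhd, hlast⟩ ⟨b₀, r₀, hp, hb₀⟩
  by_contra hnb
  suffices h : ∃ p, D.ProperNonCausalPath X Y p ∧ ¬ D.Blocks Z p by
    obtain ⟨q, hq, hqb⟩ := h
    exact hqb (hblock q hq)
  have hact := triplesActive_of_not_blocks hn hnb
  obtain ⟨l, c, t, hpe, hc, ht⟩ := exists_last_of_mem
    (P := fun v => v ∈ X ∨ D.IsColliderOn p v ∧ ∀ z ∈ Z, ¬ Relation.ReflTransGen D.Edge v z)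
    (p := p) ⟨x, by simp [hp], .inl hx⟩
  have hsuf : c :: t <:+ p := ⟨l, hpe.symm⟩
  have hlast' : (c :: t).getLast? = some y := by simpa [hpe] using hlast
  have hactZ : D.TriplesActive Z (c :: t) := by
    intro a w b hab
    have hab' := hab.trans hsuf.isInfix
    refine ⟨fun he => ?_, fun he hw => (hact a w b hab').2 he ⟨.inl hw, ?_⟩⟩
    · by_contra! hz
      exact ht w (mem_of_triple_infix_cons hab) (.inr ⟨⟨a, b, hab', he⟩, hz⟩)
    · rintro rfl
      exact Set.disjoint_left.1 hXZ hx hw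
  have hnt := hn.sublist hsuf.sublist
  have hcht : (c :: t).IsChain D.Adj := List.IsChain.suffix hch hsuf
  by_cases hcX : c ∈ X
  · obtain _ | ⟨b, t⟩ := t
    · have hcy : c = y := by simpa using hlast'
      exact (Set.disjoint_left.1 hXY hcX (hcy ▸ hy)).elim
    have hbc : D.Edge b c := by
      rcases List.eq_nil_or_concat l with rfl | ⟨l, a, rfl⟩
      · simp_all
      · have hcx : c ≠ x := by
          rintro rfl
          have hcr : c ∉ b₀ :: r₀ := (List.nodup_cons.1 (hp ▸ hn)).1
          rw [hp] at hpe
          cases l <;> grind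
        have habc : [a, c, b] <:+: p := ⟨l, t, by simp [hpe]⟩
        by_contra hbc
        exact (hact a c b habc).2 (fun he => hbc he.2) ⟨.inr hcX, hcx⟩
    have htail : D.IsActiveTail X Z y (b :: t) :=
      ⟨hnt.of_cons, hcht.tail, by simpa using hlast', fun v hv hvX => ht v hv (.inl hvX),
        hactZ.of_infix (List.suffix_cons c _).isInfix⟩
    exact htail.exists_unblocked hcX hy hbc hactZ
  · obtain ⟨⟨a, b, hab, he⟩, hcZ⟩ := hc.resolve_left hcX
    obtain ⟨v, ⟨hv | hv, -⟩, hcv⟩ := (hact a c b hab).1 he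
    · exact (hcZ v hv hcv).elim
    have htail : D.IsActiveTail X Z y (c :: t) := by
      refine ⟨hnt, hcht, hlast', ?_, hactZ⟩
      rintro u (_ | ⟨_, hu⟩)
      · exact hcX
      · exact fun huX => ht u hu (.inl huX)
    refine (htail.exists_of_reachable hy hcZ hcv).resolve_right ?_
    rintro ⟨s, hs⟩
    exact hs.avoids v (by simp) hv

end DAG
end

section
/- Let 𝐗 and 𝐘 be disjoint nonempty node sets in a DAG D. There exists a generalized back-door set relative to (𝐗,𝐘) in D if and only if the set Adjust(𝐗,𝐘,D) \ De(𝐗,D) satisfies the generalized back-door criterion relative to (𝐗,𝐘) in D. -/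
attribute [local instance] Classical.propDecidable

namespace DAG

variable {V : Type} [Fintype V] [DecidableEq V]

lemma Edge.asymm {D : DAG V} {a b : V} (h : D.Edge a b) : ¬ D.Edge b a := fun h' =>
  D.acyclic a (.tail (.single h) h')

lemma infix_triple_iff {α : Type*} {p : List α} {a w b : α} :
    [a, w, b] <:+: p ↔ ∃ i, p[i]? = some a ∧ p[i + 1]? = some w ∧ p[i + 2]? = some b := by
  rw [List.infix_iff_getElem?]
  constructor
  · rintro ⟨k, -, h⟩
    exact ⟨k, by simpa using h 0 (by simp), by simpa [Nat.add_comm] using h 1 (by simp),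
      by simpa [Nat.add_comm] using h 2 (by simp)⟩
  · rintro ⟨k, h0, h1, h2⟩
    have hlen := (List.getElem?_eq_some_iff.1 h2).1
    refine ⟨k, by simp only [List.length_cons, List.length_nil]; omega, fun i hi => ?_⟩
    have hi' : i < 3 := by simpa using hi
    interval_cases i <;> simp_all [Nat.add_comm]

/-- Blocking in terms of positions on the path. -/
lemma blocks_iff {D : DAG V} {Z : Set V} {p : List V} (hp : p.Nodup) :
    D.Blocks Z p ↔ ∃ i a w b, p[i]? = some a ∧ p[i + 1]? = some w ∧ p[i + 2]? = some b ∧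
      ((¬ (D.Edge a w ∧ D.Edge b w) ∧ w ∈ Z) ∨
        ((D.Edge a w ∧ D.Edge b w) ∧ D.Desc {w} ∩ Z = ∅)) := by
  constructor
  · rintro (⟨w, ⟨⟨a, b, h⟩, hn⟩, hw⟩ | ⟨w, ⟨a, b, h, he⟩, hw⟩)
    · obtain ⟨i, h0, h1, h2⟩ := infix_triple_iff.1 h
      exact ⟨i, a, w, b, h0, h1, h2, .inl ⟨fun he => hn ⟨a, b, h, he⟩, hw⟩⟩
    · obtain ⟨i, h0, h1, h2⟩ := infix_triple_iff.1 h
      exact ⟨i, a, w, b, h0, h1, h2, .inr ⟨he, hw⟩⟩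
  · rintro ⟨i, a, w, b, h0, h1, h2, ⟨hn, hw⟩ | ⟨he, hw⟩⟩
    · refine .inl ⟨w, ⟨⟨a, b, infix_triple_iff.2 ⟨i, h0, h1, h2⟩⟩, ?_⟩, hw⟩
      rintro ⟨a', b', h', he⟩
      obtain ⟨j, h0', h1', h2'⟩ := infix_triple_iff.1 h'
      have hij : i + 1 = j + 1 :=
        (List.getElem?_inj (List.getElem?_eq_some_iff.1 h1).1 hp).1 (h1.trans h1'.symm)
      obtain rfl : i = j := by omega
      obtain rfl : a = a' := by simpa [h0] using h0'
      obtain rfl : b = b' := by simpa [h2] using h2'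
      exact hn he
    · exact .inr ⟨w, ⟨a, b, infix_triple_iff.2 ⟨i, h0, h1, h2⟩, he⟩, hw⟩

lemma Blocks.of_take {D : DAG V} {Z : Set V} {p : List V} (hp : p.Nodup) {n : ℕ}
    (h : D.Blocks Z (p.take n)) : D.Blocks Z p := by
  obtain ⟨i, a, w, b, h0, h1, h2, h⟩ := (blocks_iff (hp.sublist (p.take_sublist n))).1 h
  have key : ∀ {j v}, (p.take n)[j]? = some v → p[j]? = some v := fun hj => by
    rw [List.getElem?_take] at hj
    split_ifs at hj
    exact hj
  exact (blocks_iff hp).2 ⟨i, a, w, b, key h0, key h1, key h2, h⟩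

lemma IsPathFrom.adj {D : DAG V} {p : List V} {x y : V} (h : D.IsPathFrom p x y) {i : ℕ}
    {a b : V} (ha : p[i]? = some a) (hb : p[i + 1]? = some b) : D.Adj a b := by
  obtain ⟨hi, rfl⟩ := List.getElem?_eq_some_iff.1 ha
  obtain ⟨hj, rfl⟩ := List.getElem?_eq_some_iff.1 hb
  exact List.isChain_iff_getElem.1 h.2.1 i hj

/-- On a path with endpoints in an ancestral set `A` that is not blocked by a subset of `A`,
every interior non-collider is in `A`. -/
lemma IsPathFrom.mem_of_not_blocks {D : DAG V} {p : List V} {x y : V} (h : D.IsPathFrom p x y)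
    {A W : Set V} (hA : ∀ a b, Relation.ReflTransGen D.Edge a b → b ∈ A → a ∈ A)
    (hx : x ∈ A) (hy : y ∈ A) (hW : W ⊆ A) (hp : ¬ D.Blocks W p) {i : ℕ} {a w b : V}
    (h0 : p[i]? = some a) (h1 : p[i + 1]? = some w) (h2 : p[i + 2]? = some b)
    (hn : ¬ (D.Edge a w ∧ D.Edge b w)) : w ∈ A := by
  have hcol : ∀ {i a w b}, p[i]? = some a → p[i + 1]? = some w → p[i + 2]? = some b →
      D.Edge a w → D.Edge b w → w ∈ A := by
    intro i a w b h0 h1 h2 ha hb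
    have hne : (D.Desc {w} ∩ W).Nonempty := Set.nonempty_iff_ne_empty.2 fun he =>
      hp ((blocks_iff h.1).2 ⟨i, a, w, b, h0, h1, h2, .inr ⟨⟨ha, hb⟩, he⟩⟩)
    obtain ⟨v, ⟨_, rfl, hv⟩, hvW⟩ := hne
    exact hA _ _ hv (hW hvW)
  have fwd : ∀ n i a b, p.length ≤ i + n → p[i]? = some a → p[i + 1]? = some b →
      D.Edge a b → a ∈ A := by
    intro n
    induction n with
    | zero =>
      intro i a b hn ha
      have := (List.getElem?_eq_some_iff.1 ha).1
      omega
    | succ n ih =>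
      intro i a b hn ha hb he
      refine hA a b (.single he) ?_
      rcases hc : p[i + 2]? with _ | c
      · have hlast : p.length = i + 2 := by
          have := (List.getElem?_eq_some_iff.1 hb).1
          have := List.getElem?_eq_none_iff.1 hc
          omega
        have hy' := h.2.2.2
        rw [List.getLast?_eq_getElem?, hlast] at hy'
        obtain rfl : b = y := by simpa [hb] using hy'
        exact hy
      · rcases h.adj hb hc with hbc | hcb
        · exact ih (i + 1) b c (by omega) hb hc hbc
        · exact hcol ha hb hc he hcb
  have bwd : ∀ i a b, p[i]? = some a → p[i + 1]? = some b → D.Edge b a → b ∈ A := by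
    intro i
    induction i with
    | zero =>
      intro a b ha hb he
      have hx' := h.2.2.1
      rw [List.head?_eq_getElem?, ha, Option.some_inj] at hx'
      exact hA b a (.single he) (hx' ▸ hx)
    | succ i ih =>
      intro a b ha hb he
      refine hA b a (.single he) ?_
      obtain ⟨c, hc⟩ : ∃ c, p[i]? = some c :=
        ⟨_, List.getElem?_eq_getElem (by have := (List.getElem?_eq_some_iff.1 ha).1; omega)⟩
      rcases h.adj hc ha with hca | hac
      · exact hcol hc ha hb hca he
      · exact ih c a hc ha hac
  rcases h.adj h0 h1 with haw | hwa
  · rcases h.adj h1 h2 with hwb | hbw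
    · exact fwd p.length _ w b (by omega) h1 h2 hwb
    · exact absurd ⟨haw, hbw⟩ hn
  · exact bwd i a w h0 h1 hwa

lemma forb_subset_desc (D : DAG V) (X Y : Set V) : D.Forb X Y ⊆ D.Desc X := by
  rintro v ⟨p, w, ⟨⟨x, hx, y, -, hp⟩, -, hc⟩, hw, -, hwv⟩
  refine ⟨x, hx, .trans ?_ hwv⟩
  obtain ⟨i, hi, rfl⟩ := List.getElem_of_mem hw
  have hx' := hp.2.2.1
  clear hwv hw
  induction i with
  | zero =>
    rw [List.head?_eq_getElem?, List.getElem?_eq_getElem hi, Option.some_inj] at hx'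
    rw [hx']
  | succ i ih => exact .tail (ih (by omega)) (List.isChain_iff_getElem.1 hc i hi)

/-- A back-door path without interior nodes in `Y` that is blocked relative to some generalized
back-door set is blocked relative to the constructive one. -/
lemma IsPathFrom.blocks_adjustSet {D : DAG V} {X Y Z : Set V} {p : List V} {x y : V}
    (h : D.IsPathFrom p x y) (hx : x ∈ X) (hy : y ∈ Y)
    (hpY : ∀ i w b, p[i]? = some w → p[i + 1]? = some b → w ∉ Y)
    (hZ : Z ∩ D.Desc X = ∅) (hb : D.Blocks ((Z ∪ X) \ {x}) p) :
    D.Blocks (((D.AdjustSet X Y \ D.Desc X) ∪ X) \ {x}) p := by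
  by_contra hp
  have hXD : ∀ v ∈ X, v ∈ D.Desc X := fun v hv => ⟨v, hv, .refl⟩
  have hhead : p[0]? = some x := by rw [← List.head?_eq_getElem?]; exact h.2.2.1
  have hne : ∀ {i w}, p[i + 1]? = some w → w ≠ x := by
    rintro i w hi rfl
    have := (List.getElem?_inj (List.getElem?_eq_some_iff.1 hi).1 h.1).1 (hi.trans hhead.symm)
    omega
  have hnc : ∀ {i a w b}, p[i]? = some a → p[i + 1]? = some w → p[i + 2]? = some b →
      ¬ (D.Edge a w ∧ D.Edge b w) → w ∉ X ∧ w ∈ D.Desc X := by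
    intro i a w b h0 h1 h2 hn
    have hwA : w ∈ D.Anc (X ∪ Y) := by
      refine h.mem_of_not_blocks (A := D.Anc (X ∪ Y)) ?_ ⟨x, .inl hx, .refl⟩
        ⟨y, .inr hy, .refl⟩ ?_ hp h0 h1 h2 hn
      · rintro a b hab ⟨c, hc, hbc⟩
        exact ⟨c, hc, hab.trans hbc⟩
      · rintro v ⟨hv | hv, -⟩
        · exact hv.1.1
        · exact ⟨v, .inl hv, .refl⟩
    have hwW : w ∉ ((D.AdjustSet X Y \ D.Desc X) ∪ X) \ {x} := fun hw =>
      hp ((blocks_iff h.1).2 ⟨i, a, w, b, h0, h1, h2, .inl ⟨hn, hw⟩⟩)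
    have hwX : w ∉ X := fun hw => hwW ⟨.inr hw, hne h1⟩
    refine ⟨hwX, ?_⟩
    by_contra hwD
    refine hwW ⟨.inl ⟨⟨hwA, ?_⟩, hwD⟩, hne h1⟩
    rintro ((hw | hw) | hw)
    · exact hwX hw
    · exact hpY _ _ _ h1 h2 hw
    · exact hwD (D.forb_subset_desc X Y hw)
  obtain ⟨i, a, w, b, h0, h1, h2, ⟨hn, hw⟩ | ⟨he, hw⟩⟩ := (blocks_iff h.1).1 hb
  · obtain ⟨hwX, hwD⟩ := hnc h0 h1 h2 hn
    rcases hw.1 with hw | hw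
    · exact (Set.eq_empty_iff_forall_notMem.1 hZ) w ⟨hw, hwD⟩
    · exact hwX hw
  · have haD : a ∈ D.Desc X := by
      cases i with
      | zero =>
        obtain rfl : x = a := by simpa [hhead] using h0
        exact hXD x hx
      | succ i =>
        obtain ⟨c, hc⟩ : ∃ c, p[i]? = some c :=
          ⟨_, List.getElem?_eq_getElem (by have := (List.getElem?_eq_some_iff.1 h0).1; omega)⟩
        exact (hnc hc h0 h1 fun h' => he.1.asymm h'.2).2
    refine hp ((blocks_iff h.1).2 ⟨i, a, w, b, h0, h1, h2, .inr ⟨he, ?_⟩⟩)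
    rw [Set.eq_empty_iff_forall_notMem] at hw ⊢
    rintro v ⟨⟨_, rfl, hwv⟩, hv | hv, hvx⟩
    · obtain ⟨u, hu, hua⟩ := haD
      exact hv.2 ⟨u, hu, (hua.tail he.1).trans hwv⟩
    · exact hw v ⟨⟨_, rfl, hwv⟩, .inr hv, hvx⟩

/-- There exists a generalized back-door set relative to `(X, Y)` in
`D` iff `Adjust(X,Y,D) \ De(X,D)` satisfies the generalized back-door criterion
relative to `(X, Y)` in `D`. -/
theorem constructive_generalized_backdoor_set
    (D : DAG V) (X Y : Set V)
    (hXY : Disjoint X Y) (hX : X.Nonempty) (hY : Y.Nonempty) :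
    (∃ Z, D.GenBackdoorCriterion X Y Z) ↔
      D.GenBackdoorCriterion X Y (D.AdjustSet X Y \ D.Desc X) := by
  refine ⟨?_, fun h => ⟨_, h⟩⟩
  rintro ⟨Z, hZ, hblock⟩
  refine ⟨by simp, fun x hx y hy p hp hback => ?_⟩
  have hex : ∃ n, ∃ v ∈ Y, p[n]? = some v :=
    ⟨p.length - 1, y, hy, by rw [← List.getLast?_eq_getElem?]; exact hp.2.2.2⟩
  obtain ⟨n, ⟨v, hv, hnv⟩, hmin⟩ : ∃ n, (∃ v ∈ Y, p[n]? = some v) ∧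
      ∀ m < n, ¬ ∃ v ∈ Y, p[m]? = some v :=
    ⟨Nat.find hex, Nat.find_spec hex, fun m hm => Nat.find_min hex hm⟩
  have hlen := (List.getElem?_eq_some_iff.1 hnv).1
  obtain ⟨b, rest, rfl, hbx⟩ := hback
  cases n with
  | zero =>
    obtain rfl : x = v := by simpa using hnv
    exact absurd hv (Set.disjoint_left.1 hXY hx)
  | succ n =>
    have hq : D.IsPathFrom ((x :: b :: rest).take (n + 1 + 1)) x v := by
      refine ⟨hp.1.sublist (List.take_sublist _ _), hp.2.1.take _, by simp, ?_⟩
      rw [List.getLast?_eq_getElem?, List.length_take, min_eq_left hlen, List.getElem?_take]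
      simpa using hnv
    refine Blocks.of_take hp.1 (hq.blocks_adjustSet hx hv ?_ hZ
      (hblock x hx v hv _ hq ⟨b, rest.take n, by simp, hbx⟩))
    intro i w c hi hc hw
    rw [List.getElem?_take] at hi hc
    split_ifs at hi hc with h1 h2
    exact hmin i (by omega) ⟨w, hw, hi⟩

end DAG
end
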